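/- Let ω ∈ D̂ with ∫_0^1 ω(r) dr = 1, let α > 0, and let r_n ∈ [0,1) satisfy ω̂(r_n) = 2^{-nα}, with M_n = ⌊1/(1-r_n)⌋. Then for each 0 < β < 1 there exists a constant C = C(α, β, ω) > 0 such that 2^{-nαβ} ∫_0^1 r^{M_n} ω(r) ω̂(r)^{-β} dr ≤ C ∫_0^1 r^{M_n} ω(r) dr for all n ∈ ℕ∪{0}. -/

import Mathlib

open MeasureTheory Set

open scoped ENNReal

noncomputable section

/-- `wh ω r = ω̂(r) = ∫_r^1 ω(s) ds`. -/
def wh (ω : ℝ → ℝ) (r : ℝ) : ℝ := ∫ s in r..1, ω s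

/-- `M_n = ⌊1/(1-r_n)⌋`. -/
def Mfl (r : ℕ → ℝ) (n : ℕ) : ℕ := Nat.floor (1 / (1 - r n))

section Tail

variable {ω : ℝ → ℝ}

theorem ofReal_wh_eq (hnn : ∀ x, 0 ≤ ω x) (hint : IntegrableOn ω (Ioo 0 1)) {a : ℝ}
    (ha0 : 0 ≤ a) (ha1 : a ≤ 1) :
    ENNReal.ofReal (wh ω a) = ∫⁻ x in Ioo a 1, ENNReal.ofReal (ω x) := by
  rw [wh, intervalIntegral.integral_of_le ha1, integral_Ioc_eq_integral_Ioo]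
  exact ofReal_integral_eq_lintegral_ofReal (hint.mono_set (Ioo_subset_Ioo_left ha0))
    (ae_of_all _ hnn)

theorem wh_nonneg (hnn : ∀ x, 0 ≤ ω x) {a : ℝ} (ha1 : a ≤ 1) : 0 ≤ wh ω a :=
  intervalIntegral.integral_nonneg ha1 fun x _ => hnn x

theorem wh_anti (hnn : ∀ x, 0 ≤ ω x) (hint : IntegrableOn ω (Ioo 0 1)) {a b : ℝ}
    (ha0 : 0 ≤ a) (hab : a ≤ b) (hb1 : b ≤ 1) : wh ω b ≤ wh ω a := by
  rw [← ENNReal.ofReal_le_ofReal_iff (wh_nonneg hnn (hab.trans hb1)),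
    ofReal_wh_eq hnn hint ha0 (hab.trans hb1), ofReal_wh_eq hnn hint (ha0.trans hab) hb1]
  exact lintegral_mono_set (Ioo_subset_Ioo_left hab)

theorem continuousOn_wh (hint : IntegrableOn ω (Ioo 0 1)) : ContinuousOn (wh ω) (Icc 0 1) := by
  have h := intervalIntegral.continuousOn_primitive_interval_left (a := 0) (b := 1)
    (f := ω) (μ := volume)
    (by rwa [uIcc_of_le zero_le_one, integrableOn_Icc_iff_integrableOn_Ioo])
  rwa [uIcc_of_le zero_le_one] at h

theorem measurableSet_Ioo_inter_wh_preimage (hint : IntegrableOn ω (Ioo 0 1)) {a : ℝ}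
    (ha0 : 0 ≤ a) {U : Set ℝ} (hU : IsOpen U) : MeasurableSet (Ioo a 1 ∩ wh ω ⁻¹' U) := by
  have hsub : Ioo a 1 ⊆ Icc 0 1 := fun x hx => ⟨ha0.trans hx.1.le, hx.2.le⟩
  exact (((continuousOn_wh hint).mono hsub).isOpen_inter_preimage isOpen_Ioo hU).measurableSet

/-- The mass that `ω` gives to a sublevel set of its tail integral. -/
theorem lintegral_sublevel_wh_le (hnn : ∀ x, 0 ≤ ω x) (hint : IntegrableOn ω (Ioo 0 1)) {a t : ℝ}
    (ha0 : 0 ≤ a) (ha1 : a < 1) (ht : 0 < t) :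
    ∫⁻ x in Ioo a 1 ∩ {x | wh ω x < t}, ENNReal.ofReal (ω x) ≤ ENNReal.ofReal t := by
  rcases lt_or_ge (wh ω a) t with h | h
  · calc _ ≤ ∫⁻ x in Ioo a 1, ENNReal.ofReal (ω x) := lintegral_mono_set inter_subset_left
      _ = ENNReal.ofReal (wh ω a) := (ofReal_wh_eq hnn hint ha0 ha1.le).symm
      _ ≤ _ := ENNReal.ofReal_le_ofReal h.le
  · obtain ⟨b, hb, hbt⟩ : t ∈ wh ω '' Icc a 1 :=
      intermediate_value_Icc' ha1.le ((continuousOn_wh hint).mono (Icc_subset_Icc_left ha0))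
        ⟨by simpa [wh] using ht.le, h⟩
    calc _ ≤ ∫⁻ x in Ioo b 1, ENNReal.ofReal (ω x) := by
          refine lintegral_mono_set fun x hx => ⟨?_, hx.1.2⟩
          by_contra! hxb
          have h1 := wh_anti hnn hint (ha0.trans hx.1.1.le) hxb hb.2
          have h2 : wh ω x < t := hx.2
          linarith
      _ = ENNReal.ofReal t := by rw [← ofReal_wh_eq hnn hint (ha0.trans hb.1) hb.2, hbt]

theorem lintegral_div_wh_rpow_band_le (hnn : ∀ x, 0 ≤ ω x) (hint : IntegrableOn ω (Ioo 0 1))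
    {a c β : ℝ} (ha0 : 0 ≤ a) (ha1 : a < 1) (hc : 0 < c) (hβ0 : 0 < β) :
    ∫⁻ x in Ioo a 1 ∩ wh ω ⁻¹' Ioo c (4 * c), ENNReal.ofReal (ω x / wh ω x ^ β) ≤
      ENNReal.ofReal (4 * c ^ (1 - β)) := by
  have hmeas : MeasurableSet (Ioo a 1 ∩ wh ω ⁻¹' Ioo c (4 * c)) :=
    measurableSet_Ioo_inter_wh_preimage hint ha0 isOpen_Ioo
  calc _ ≤ ∫⁻ x in Ioo a 1 ∩ wh ω ⁻¹' Ioo c (4 * c),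
          ENNReal.ofReal (c ^ (-β)) * ENNReal.ofReal (ω x) := by
        refine setLIntegral_mono' hmeas fun x hx => ?_
        rw [← ENNReal.ofReal_mul (by positivity)]
        apply ENNReal.ofReal_le_ofReal
        rw [Real.rpow_neg hc.le, mul_comm, ← div_eq_mul_inv]
        exact div_le_div_of_nonneg_left (hnn x) (by positivity)
          (Real.rpow_le_rpow hc.le hx.2.1.le hβ0.le)
    _ = ENNReal.ofReal (c ^ (-β)) *
          ∫⁻ x in Ioo a 1 ∩ wh ω ⁻¹' Ioo c (4 * c), ENNReal.ofReal (ω x) :=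
        lintegral_const_mul' _ _ ENNReal.ofReal_ne_top
    _ ≤ ENNReal.ofReal (c ^ (-β)) * ENNReal.ofReal (4 * c) := by
        gcongr
        exact (lintegral_mono_set (inter_subset_inter_right _ fun x hx => hx.2)).trans
          (lintegral_sublevel_wh_le hnn hint ha0 ha1 (by positivity))
    _ = _ := by
        rw [← ENNReal.ofReal_mul (by positivity), sub_eq_neg_add, Real.rpow_add hc, Real.rpow_one]
        ring_nf

/-- A dyadic form of `∫_a^1 ω ω̂^{-β} = ω̂(a)^{1-β} / (1-β)`. -/
theorem lintegral_div_wh_rpow_le (hnn : ∀ x, 0 ≤ ω x) (hint : IntegrableOn ω (Ioo 0 1))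
    {a β : ℝ} (ha0 : 0 ≤ a) (ha1 : a < 1) (hpos : 0 < wh ω a) (hβ0 : 0 < β) (hβ1 : β < 1) :
    ∫⁻ x in Ioo a 1, ENNReal.ofReal (ω x / wh ω x ^ β) ≤
      ENNReal.ofReal (4 * wh ω a ^ (1 - β) / (1 - (1 / 2) ^ (1 - β))) := by
  set w := wh ω a with hw
  set q : ℝ := (1 / 2) ^ (1 - β) with hq
  have hq0 : 0 < q := by positivity
  have hq1 : q < 1 := Real.rpow_lt_one (by norm_num) (by norm_num) (by linarith)
  let c : ℕ → ℝ := fun k => w / 2 * (1 / 2) ^ k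
  have hc : ∀ k, 0 < c k := fun k => by positivity
  let E : ℕ → Set ℝ := fun k => Ioo a 1 ∩ wh ω ⁻¹' Ioo (c k) (4 * c k)
  have hcover : Ioo a 1 ⊆ (Ioo a 1 ∩ {x | wh ω x = 0}) ∪ ⋃ k, E k := by
    intro x hx
    rcases (wh_nonneg (a := x) hnn hx.2.le).eq_or_lt with h0 | h0
    · exact Or.inl ⟨hx, h0.symm⟩
    · right
      have hle : wh ω x / w ≤ 1 := (div_le_one hpos).2 (wh_anti hnn hint ha0 hx.1.le hx.2.le)
      obtain ⟨k, hk1, hk2⟩ := exists_nat_pow_near_of_lt_one (div_pos h0 hpos) hle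
        (y := (1 / 2 : ℝ)) (by norm_num) (by norm_num)
      rw [lt_div_iff₀ hpos, pow_succ] at hk1
      rw [div_le_iff₀ hpos] at hk2
      have hkpos : 0 < (1 / 2 : ℝ) ^ k * w := by positivity
      refine mem_iUnion.2 ⟨k, hx, ?_, ?_⟩ <;> simp only [c] <;> nlinarith
  have hzero : ∫⁻ x in Ioo a 1 ∩ {x | wh ω x = 0}, ENNReal.ofReal (ω x / wh ω x ^ β) ≤ 0 := by
    have hmeas : MeasurableSet (Ioo a 1 ∩ {x | wh ω x = 0}) := by
      have ho := measurableSet_Ioo_inter_wh_preimage hint ha0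
        (isOpen_compl_singleton (x := (0 : ℝ)))
      convert measurableSet_Ioo.diff ho using 1
      ext x
      simp
      tauto
    refine (setLIntegral_mono' hmeas (g := 0) fun x hx => ?_).trans (by simp)
    have h0 : wh ω x = 0 := hx.2
    simp [h0, Real.zero_rpow hβ0.ne']
  have hterm : ∀ k, ∫⁻ x in E k, ENNReal.ofReal (ω x / wh ω x ^ β) ≤
      ENNReal.ofReal (4 * w ^ (1 - β) * q ^ k) := fun k => by
    refine (lintegral_div_wh_rpow_band_le hnn hint ha0 ha1 (hc k) hβ0).trans
      (ENNReal.ofReal_le_ofReal ?_)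
    have h1 : c k ^ (1 - β) = (w / 2) ^ (1 - β) * q ^ k := by
      rw [Real.mul_rpow (by positivity) (by positivity), hq, ← Real.rpow_natCast,
        ← Real.rpow_natCast, ← Real.rpow_mul (by norm_num), ← Real.rpow_mul (by norm_num),
        mul_comm (k : ℝ)]
    have h2 : (w / 2) ^ (1 - β) ≤ w ^ (1 - β) :=
      Real.rpow_le_rpow (by positivity) (by linarith) (by linarith)
    rw [h1, mul_assoc]
    gcongr
  calc _ ≤ ∫⁻ x in (Ioo a 1 ∩ {x | wh ω x = 0}) ∪ ⋃ k, E k,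
          ENNReal.ofReal (ω x / wh ω x ^ β) := lintegral_mono_set hcover
    _ ≤ 0 + ∑' k, ∫⁻ x in E k, ENNReal.ofReal (ω x / wh ω x ^ β) :=
        (lintegral_union_le _ _ _).trans (add_le_add hzero (lintegral_iUnion_le _ _))
    _ ≤ ∑' k, ENNReal.ofReal (4 * w ^ (1 - β) * q ^ k) := by
        rw [zero_add]
        exact ENNReal.tsum_le_tsum hterm
    _ = _ := by
        rw [← ENNReal.ofReal_tsum_of_nonneg (fun k => by positivity)
          ((summable_geometric_of_lt_one hq0.le hq1).mul_left _), tsum_mul_left,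
          tsum_geometric_of_lt_one hq0.le hq1, div_eq_mul_inv]

/-- The doubling condition bounds `ω̂(a)` by the moment of `ω` of order `⌊1/(1-a)⌋`. -/
theorem wh_le_moment (hnn : ∀ x, 0 ≤ ω x) (hint : IntegrableOn ω (Ioo 0 1)) {a C : ℝ}
    (ha0 : 0 ≤ a) (ha1 : a < 1) (hC : 0 ≤ C) (hdbl : wh ω a ≤ C * wh ω ((1 + a) / 2)) {M : ℕ}
    (hM : M * (1 - a) ≤ 1) :
    ENNReal.ofReal (wh ω a) ≤
      ENNReal.ofReal (2 * C) * ∫⁻ x in Ioo (0 : ℝ) 1, ENNReal.ofReal (x ^ M * ω x) := by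
  set ρ := (1 + a) / 2 with hρ
  have hρ0 : 0 < ρ := by linarith
  have hρ1 : ρ < 1 := by linarith
  have hpow : 1 / 2 ≤ ρ ^ M := by
    have h := one_add_mul_le_pow (a := ρ - 1) (by linarith) M
    have h2 : 1 + (ρ - 1) = ρ := by ring
    rw [h2] at h
    have h3 : (M : ℝ) * (ρ - 1) = -(M * (1 - a)) / 2 := by rw [hρ]; ring
    linarith
  calc ENNReal.ofReal (wh ω a) ≤ ENNReal.ofReal (2 * C * (1 / 2 * wh ω ρ)) :=
        ENNReal.ofReal_le_ofReal (by linarith)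
    _ = ENNReal.ofReal (2 * C) * (ENNReal.ofReal (1 / 2) *
          ∫⁻ x in Ioo ρ 1, ENNReal.ofReal (ω x)) := by
        rw [ENNReal.ofReal_mul (by positivity), ENNReal.ofReal_mul (p := 1 / 2) (by norm_num),
          ofReal_wh_eq hnn hint hρ0.le hρ1.le]
    _ ≤ _ := by
        gcongr
        rw [← lintegral_const_mul' _ _ ENNReal.ofReal_ne_top]
        refine le_trans (setLIntegral_mono' measurableSet_Ioo fun x hx => ?_)
          (lintegral_mono_set (Ioo_subset_Ioo_left hρ0.le))
        rw [← ENNReal.ofReal_mul (by norm_num)]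
        apply ENNReal.ofReal_le_ofReal
        exact mul_le_mul_of_nonneg_right
          (hpow.trans (pow_le_pow_left₀ hρ0.le hx.1.le M)) (hnn x)

end Tail

/-- For `ω ∈ D̂` with `ω̂(0)=1`, `α > 0` and `0 < β < 1`:
`2^{-nαβ} ∫_0^1 r^{M_n} ω(r) ω̂(r)^{-β} dr ≤ C ∫_0^1 r^{M_n} ω(r) dr` for all `n`. -/
theorem stmt10 (α : ℝ) (hα : 0 < α)
    (ω : ℝ → ℝ) (hnn : ∀ x, 0 ≤ ω x) (hint : IntegrableOn ω (Set.Ioo 0 1))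
    (hdbl : ∃ C : ℝ, 1 ≤ C ∧ ∀ x : ℝ, 0 ≤ x → x < 1 → wh ω x ≤ C * wh ω ((1 + x) / 2))
    (hone : wh ω 0 = 1)
    (r : ℕ → ℝ) (hr : ∀ n, 0 ≤ r n ∧ r n < 1) (hr0 : r 0 = 0)
    (hrn : ∀ n : ℕ, wh ω (r n) = 2 ^ (-(n : ℝ) * α))
    (β : ℝ) (hβ0 : 0 < β) (hβ1 : β < 1) :
    ∃ C > (0:ℝ), ∀ n : ℕ,
      ENNReal.ofReal (2 ^ (-(n : ℝ) * α * β)) *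
          (∫⁻ x in Set.Ioo (0:ℝ) 1, ENNReal.ofReal (x ^ Mfl r n * ω x / wh ω x ^ β)) ≤
        ENNReal.ofReal C *
          ∫⁻ x in Set.Ioo (0:ℝ) 1, ENNReal.ofReal (x ^ Mfl r n * ω x) := by
  obtain ⟨C, hC1, hC⟩ := hdbl
  set q : ℝ := (1 / 2) ^ (1 - β) with hq
  have hq1 : q < 1 := Real.rpow_lt_one (by norm_num) (by norm_num) (by linarith)
  have hK : 0 < 4 / (1 - q) := div_pos (by norm_num) (by linarith)
  have hC0 : 0 ≤ C := by linarith
  refine ⟨1 + 4 / (1 - q) * (2 * C), by positivity, fun n => ?_⟩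
  obtain ⟨ha0, ha1⟩ := hr n
  set M := Mfl r n with hMdef
  have hMle : (M : ℝ) * (1 - r n) ≤ 1 := by
    have h1 : 0 < 1 - r n := by linarith
    rw [← le_div_iff₀ h1]
    exact Nat.floor_le (by positivity)
  have hpos : 0 < wh ω (r n) := by rw [hrn n]; positivity
  have hscale : (2 : ℝ) ^ (-(n : ℝ) * α * β) = wh ω (r n) ^ β := by
    rw [hrn n, ← Real.rpow_mul (by norm_num)]
  rw [hscale]
  set w := wh ω (r n) with hw
  have hsplit : Ioo (0 : ℝ) 1 ⊆ Ioc 0 (r n) ∪ Ioo (r n) 1 := fun x hx =>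
    (le_or_gt x (r n)).imp (fun h => ⟨hx.1, h⟩) fun h => ⟨h, hx.2⟩
  have hleft : ENNReal.ofReal (w ^ β) *
      (∫⁻ x in Ioc 0 (r n), ENNReal.ofReal (x ^ M * ω x / wh ω x ^ β)) ≤
        ∫⁻ x in Ioo (0 : ℝ) 1, ENNReal.ofReal (x ^ M * ω x) := by
    rw [← lintegral_const_mul' _ _ ENNReal.ofReal_ne_top]
    refine le_trans (setLIntegral_mono' measurableSet_Ioc fun x hx => ?_)
      (lintegral_mono_set fun x hx => ⟨hx.1, hx.2.trans_lt ha1⟩)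
    rw [← ENNReal.ofReal_mul (by positivity)]
    apply ENNReal.ofReal_le_ofReal
    have hwx : w ≤ wh ω x := wh_anti hnn hint hx.1.le hx.2 ha1.le
    have hle : w ^ β ≤ wh ω x ^ β := Real.rpow_le_rpow hpos.le hwx hβ0.le
    have hxpos : 0 < wh ω x ^ β := Real.rpow_pos_of_pos (hpos.trans_le hwx) _
    rw [← mul_div_assoc, div_le_iff₀ hxpos, mul_comm]
    exact mul_le_mul_of_nonneg_left hle (mul_nonneg (pow_nonneg hx.1.le _) (hnn x))
  have hright : ENNReal.ofReal (w ^ β) *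
      (∫⁻ x in Ioo (r n) 1, ENNReal.ofReal (x ^ M * ω x / wh ω x ^ β)) ≤
        ENNReal.ofReal (4 / (1 - q)) * ENNReal.ofReal w := by
    calc _ ≤ ENNReal.ofReal (w ^ β) *
          ∫⁻ x in Ioo (r n) 1, ENNReal.ofReal (ω x / wh ω x ^ β) := by
          gcongr 1
          refine setLIntegral_mono' measurableSet_Ioo fun x hx => ENNReal.ofReal_le_ofReal ?_
          have hx0 : 0 ≤ x := ha0.trans hx.1.le
          exact div_le_div_of_nonneg_right
            (mul_le_of_le_one_left (hnn x) (pow_le_one₀ hx0 hx.2.le))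
            (Real.rpow_nonneg (wh_nonneg hnn hx.2.le) _)
      _ ≤ ENNReal.ofReal (w ^ β) * ENNReal.ofReal (4 * w ^ (1 - β) / (1 - q)) := by
          gcongr
          exact lintegral_div_wh_rpow_le hnn hint ha0 ha1 hpos hβ0 hβ1
      _ = _ := by
          rw [← ENNReal.ofReal_mul (by positivity), ← ENNReal.ofReal_mul hK.le]
          congr 1
          have h : w ^ β * w ^ (1 - β) = w := by
            rw [← Real.rpow_add hpos]
            simp
          calc _ = 4 / (1 - q) * (w ^ β * w ^ (1 - β)) := by ring
            _ = _ := by rw [h]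
  calc _ ≤ ENNReal.ofReal (w ^ β) *
        ((∫⁻ x in Ioc 0 (r n), ENNReal.ofReal (x ^ M * ω x / wh ω x ^ β)) +
          ∫⁻ x in Ioo (r n) 1, ENNReal.ofReal (x ^ M * ω x / wh ω x ^ β)) := by
        gcongr
        exact (lintegral_mono_set hsplit).trans (lintegral_union_le _ _ _)
    _ ≤ (∫⁻ x in Ioo (0 : ℝ) 1, ENNReal.ofReal (x ^ M * ω x)) +
          ENNReal.ofReal (4 / (1 - q)) * (ENNReal.ofReal (2 * C) *
            ∫⁻ x in Ioo (0 : ℝ) 1, ENNReal.ofReal (x ^ M * ω x)) := by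
        rw [mul_add]
        refine add_le_add hleft (hright.trans ?_)
        gcongr
        exact wh_le_moment hnn hint ha0 ha1 hC0 (hC _ ha0 ha1) hMle
    _ = _ := by
        rw [ENNReal.ofReal_add zero_le_one (by positivity), ENNReal.ofReal_mul hK.le,
          ENNReal.ofReal_one, add_mul, one_mul, mul_assoc]
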